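/- Triangle comparison (nonnegative curvature): let (X₀,d₀,m₀) and (X₁,d₁,m₁) be metric measure spaces of finite L²-size, let μ̄ ∈ Cpl(m₀,m₁) be an optimal coupling for the L²-distortion distance DD, and for t ∈ [0,1] let X_t denote the gauged measure space (X₀×X₁, (1−t)d₀ + t d₁, μ̄). Then for every metric measure space (X',d',m') of finite L²-size and every t ∈ [0,1]: DD(X_t, X')² ≥ (1−t)·DD(X₀, X')² + t·DD(X₁, X')² − t(1−t)·DD(X₀, X₁)². -/

import Mathlib

open MeasureTheory ENNReal

/-- The set of couplings of two measures: measures on the product whose marginals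
are the two given measures. -/
def Cpl {α β : Type*} [MeasurableSpace α] [MeasurableSpace β]
    (m₀ : Measure α) (m₁ : Measure β) : Set (Measure (α × β)) :=
  {μ | μ.map Prod.fst = m₀ ∧ μ.map Prod.snd = m₁}

/-- The `L²`-distortion of a coupling `μ` of two gauged (e.g. metric) measure
spaces with gauges `f₀` and `f₁`:
`(∬ |f₀(x₀,y₀) − f₁(x₁,y₁)|² dμ dμ)^(1/2)`. -/
noncomputable def distortion2 {α β : Type*} [MeasurableSpace α] [MeasurableSpace β]
    (f₀ : α → α → ℝ) (f₁ : β → β → ℝ) (μ : Measure (α × β)) : ℝ≥0∞ :=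
  (∫⁻ z, ∫⁻ w, ENNReal.ofReal ((f₀ z.1 w.1 - f₁ z.2 w.2) ^ 2) ∂μ ∂μ) ^ (1 / 2 : ℝ)

/-- The `L²`-distortion distance between two gauged (e.g. metric) measure spaces:
the infimum of the `L²`-distortion over all couplings. -/
noncomputable def DD2 {α β : Type*} [MeasurableSpace α] [MeasurableSpace β]
    (f₀ : α → α → ℝ) (f₁ : β → β → ℝ) (m₀ : Measure α) (m₁ : Measure β) : ℝ≥0∞ :=
  ⨅ μ ∈ Cpl m₀ m₁, distortion2 f₀ f₁ μ

/-- The convex combination gauge `(1−t)·d₀ + t·d₁` on the product of two metric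
spaces. -/
noncomputable def convexGauge {α β : Type*} [Dist α] [Dist β] (t : ℝ) :
    (α × β) → (α × β) → ℝ :=
  fun z w => (1 - t) * dist z.1 w.1 + t * dist z.2 w.2

theorem distortion2_sq {α β : Type*} [MeasurableSpace α] [MeasurableSpace β]
    (f₀ : α → α → ℝ) (f₁ : β → β → ℝ) (μ : Measure (α × β)) :
    distortion2 f₀ f₁ μ ^ 2 =
      ∫⁻ z, ∫⁻ w, ENNReal.ofReal ((f₀ z.1 w.1 - f₁ z.2 w.2) ^ 2) ∂μ ∂μ := by
  rw [distortion2, ← ENNReal.rpow_natCast, ← ENNReal.rpow_mul]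
  norm_num

theorem isProbabilityMeasure_of_mem_Cpl {α β : Type*} [MeasurableSpace α] [MeasurableSpace β]
    {m₀ : Measure α} {m₁ : Measure β} [IsProbabilityMeasure m₀] {μ : Measure (α × β)}
    (hμ : μ ∈ Cpl m₀ m₁) : IsProbabilityMeasure μ := by
  have h : IsProbabilityMeasure (μ.map Prod.fst) := by rw [hμ.1]; infer_instance
  exact (Measure.isProbabilityMeasure_map_iff measurable_fst.aemeasurable).1 h

theorem prod_mem_Cpl {α β : Type*} [MeasurableSpace α] [MeasurableSpace β]
    (m₀ : Measure α) (m₁ : Measure β) [IsProbabilityMeasure m₀] [IsProbabilityMeasure m₁] :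
    m₀.prod m₁ ∈ Cpl m₀ m₁ := by
  constructor
  · simp [Measure.map_fst_prod]
  · simp [Measure.map_snd_prod]

theorem map_prodMap_fst_mem_Cpl {α β γ : Type*} [MeasurableSpace α] [MeasurableSpace β]
    [MeasurableSpace γ] {m : Measure α} {m' : Measure β} {ν : Measure (α × β)}
    (hν : ν ∈ Cpl m m') {g : α → γ} (hg : Measurable g) :
    ν.map (Prod.map g id) ∈ Cpl (m.map g) m' := by
  constructor
  · rw [Measure.map_map measurable_fst (hg.prodMap measurable_id), ← hν.1,
      Measure.map_map hg measurable_fst]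
    rfl
  · rw [Measure.map_map measurable_snd (hg.prodMap measurable_id), ← hν.2]
    rfl

theorem lintegral_lintegral_map {α β : Type*} [MeasurableSpace α] [MeasurableSpace β]
    {μ : Measure α} [SFinite μ] {g : α → β} (hg : Measurable g) {F : β → β → ℝ≥0∞}
    (hF : Measurable (Function.uncurry F)) :
    ∫⁻ z, ∫⁻ w, F z w ∂(μ.map g) ∂(μ.map g) = ∫⁻ z, ∫⁻ w, F (g z) (g w) ∂μ ∂μ := by
  have hFi : Measurable fun z => ∫⁻ w, F z w ∂(μ.map g) := hF.lintegral_prod_right'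
  rw [lintegral_map hFi hg]
  refine lintegral_congr fun z => ?_
  exact lintegral_map (hF.comp measurable_prodMk_left) hg

theorem lintegral_lintegral_linear_combination {α : Type*} [MeasurableSpace α]
    {μ : Measure α} [SFinite μ] {F G : α → α → ℝ≥0∞}
    (hF : Measurable (Function.uncurry F)) (hG : Measurable (Function.uncurry G)) (a b : ℝ≥0∞) :
    ∫⁻ z, ∫⁻ w, (a * F z w + b * G z w) ∂μ ∂μ =
      a * ∫⁻ z, ∫⁻ w, F z w ∂μ ∂μ + b * ∫⁻ z, ∫⁻ w, G z w ∂μ ∂μ := by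
  have hF' (z : α) : Measurable (F z) := hF.comp measurable_prodMk_left
  have hG' (z : α) : Measurable (G z) := hG.comp measurable_prodMk_left
  have hFi : Measurable fun z => ∫⁻ w, F z w ∂μ := hF.lintegral_prod_right'
  have hGi : Measurable fun z => ∫⁻ w, G z w ∂μ := hG.lintegral_prod_right'
  rw [← lintegral_const_mul a hFi, ← lintegral_const_mul b hGi,
    ← lintegral_add_left (hFi.const_mul a)]
  refine lintegral_congr fun z => ?_
  rw [lintegral_add_left ((hF' z).const_mul a), lintegral_const_mul a (hF' z),
    lintegral_const_mul b (hG' z)]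

theorem DD2_le_distortion2 {α β : Type*} [MeasurableSpace α] [MeasurableSpace β]
    (f₀ : α → α → ℝ) (f₁ : β → β → ℝ) {m₀ : Measure α} {m₁ : Measure β}
    {μ : Measure (α × β)} (hμ : μ ∈ Cpl m₀ m₁) : DD2 f₀ f₁ m₀ m₁ ≤ distortion2 f₀ f₁ μ :=
  iInf₂_le μ hμ

theorem le_DD2_sq {α β : Type*} [MeasurableSpace α] [MeasurableSpace β]
    {f₀ : α → α → ℝ} {f₁ : β → β → ℝ} {m₀ : Measure α} {m₁ : Measure β} {A : ℝ≥0∞}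
    (h : ∀ μ ∈ Cpl m₀ m₁, A ≤ distortion2 f₀ f₁ μ ^ 2) : A ≤ DD2 f₀ f₁ m₀ m₁ ^ 2 := by
  have key : A ^ (1 / 2 : ℝ) ≤ DD2 f₀ f₁ m₀ m₁ := by
    refine le_iInf₂ fun μ hμ => ?_
    calc A ^ (1 / 2 : ℝ) ≤ (distortion2 f₀ f₁ μ ^ 2) ^ (1 / 2 : ℝ) :=
          ENNReal.rpow_le_rpow (h μ hμ) (by norm_num)
      _ = distortion2 f₀ f₁ μ := by
          rw [← ENNReal.rpow_natCast, ← ENNReal.rpow_mul]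
          norm_num
  calc A = (A ^ (1 / 2 : ℝ)) ^ 2 := by
        rw [← ENNReal.rpow_natCast, ← ENNReal.rpow_mul]
        norm_num
    _ ≤ _ := by gcongr

/-- Couplings of gauged measure spaces of finite `L²`-size have finite distortion. -/
theorem distortion2_ne_top {α β : Type*} [MeasurableSpace α] [MeasurableSpace β]
    {f₀ : α → α → ℝ} {f₁ : β → β → ℝ} (hf₀ : Measurable (Function.uncurry f₀))
    (hf₁ : Measurable (Function.uncurry f₁)) {m₀ : Measure α} {m₁ : Measure β}
    [IsProbabilityMeasure m₀]
    (h₀ : (∫⁻ x, ∫⁻ y, ENNReal.ofReal (f₀ x y ^ 2) ∂m₀ ∂m₀) ≠ ⊤)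
    (h₁ : (∫⁻ x, ∫⁻ y, ENNReal.ofReal (f₁ x y ^ 2) ∂m₁ ∂m₁) ≠ ⊤)
    {μ : Measure (α × β)} (hμ : μ ∈ Cpl m₀ m₁) : distortion2 f₀ f₁ μ ≠ ⊤ := by
  have := isProbabilityMeasure_of_mem_Cpl hμ
  have hF₀ : Measurable (Function.uncurry fun x y => ENNReal.ofReal (f₀ x y ^ 2)) :=
    (hf₀.pow_const 2).ennreal_ofReal
  have hF₁ : Measurable (Function.uncurry fun x y => ENNReal.ofReal (f₁ x y ^ 2)) :=
    (hf₁.pow_const 2).ennreal_ofReal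
  rw [← hμ.1, lintegral_lintegral_map measurable_fst hF₀] at h₀
  rw [← hμ.2, lintegral_lintegral_map measurable_snd hF₁] at h₁
  have hle : distortion2 f₀ f₁ μ ^ 2 ≤
      2 * ∫⁻ z, ∫⁻ w, ENNReal.ofReal (f₀ z.1 w.1 ^ 2) ∂μ ∂μ +
        2 * ∫⁻ z, ∫⁻ w, ENNReal.ofReal (f₁ z.2 w.2 ^ 2) ∂μ ∂μ := by
    have hG₀ : Measurable (Function.uncurry fun z w : α × β =>
        ENNReal.ofReal (f₀ z.1 w.1 ^ 2)) :=
      hF₀.comp (measurable_fst.prodMap measurable_fst)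
    have hG₁ : Measurable (Function.uncurry fun z w : α × β =>
        ENNReal.ofReal (f₁ z.2 w.2 ^ 2)) :=
      hF₁.comp (measurable_snd.prodMap measurable_snd)
    rw [distortion2_sq, ← lintegral_lintegral_linear_combination hG₀ hG₁]
    refine lintegral_mono fun z => lintegral_mono fun w => ?_
    calc ENNReal.ofReal ((f₀ z.1 w.1 - f₁ z.2 w.2) ^ 2)
        ≤ ENNReal.ofReal (2 * f₀ z.1 w.1 ^ 2 + 2 * f₁ z.2 w.2 ^ 2) :=
          ENNReal.ofReal_le_ofReal (by nlinarith [sq_nonneg (f₀ z.1 w.1 + f₁ z.2 w.2)])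
      _ = _ := by
          rw [ENNReal.ofReal_add (by positivity) (by positivity),
            ENNReal.ofReal_mul (by norm_num), ENNReal.ofReal_mul (by norm_num)]
          norm_num
  intro htop
  rw [htop] at hle
  have hfin := ENNReal.add_ne_top.2
    ⟨ENNReal.mul_ne_top (a := 2) (by norm_num) h₀, ENNReal.mul_ne_top (a := 2) (by norm_num) h₁⟩
  exact hfin (top_le_iff.1 (by rwa [ENNReal.top_pow two_ne_zero] at hle))

/-- The parallelogram-type identity for the distortion of a coupling of `X_t` with `X'`. -/
theorem distortion2_convexGauge_sq_add {X₀ X₁ X' : Type*}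
    [MetricSpace X₀] [SecondCountableTopology X₀] [MeasurableSpace X₀] [BorelSpace X₀]
    [MetricSpace X₁] [SecondCountableTopology X₁] [MeasurableSpace X₁] [BorelSpace X₁]
    [MetricSpace X'] [SecondCountableTopology X'] [MeasurableSpace X'] [BorelSpace X']
    (ν : Measure ((X₀ × X₁) × X')) [SFinite ν] {t : ℝ} (ht0 : 0 ≤ t) (ht1 : t ≤ 1) :
    distortion2 (convexGauge t) dist ν ^ 2 +
        ENNReal.ofReal (t * (1 - t)) * distortion2 dist dist (ν.map Prod.fst) ^ 2 =
      ENNReal.ofReal (1 - t) * distortion2 dist dist (ν.map (Prod.map Prod.fst id)) ^ 2 +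
        ENNReal.ofReal t * distortion2 dist dist (ν.map (Prod.map Prod.snd id)) ^ 2 := by
  have hs : 0 ≤ 1 - t := sub_nonneg.2 ht1
  simp only [distortion2_sq]
  rw [lintegral_lintegral_map measurable_fst (by unfold Function.uncurry; fun_prop),
    lintegral_lintegral_map (by fun_prop) (by unfold Function.uncurry; fun_prop),
    lintegral_lintegral_map (by fun_prop) (by unfold Function.uncurry; fun_prop)]
  rw [← lintegral_lintegral_linear_combination (by unfold Function.uncurry; fun_prop)
    (by unfold Function.uncurry; fun_prop)]
  rw [← one_mul (∫⁻ z, ∫⁻ w, ENNReal.ofReal ((convexGauge t z.1 w.1 - dist z.2 w.2) ^ 2) ∂ν ∂ν),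
    ← lintegral_lintegral_linear_combination
      (by unfold Function.uncurry convexGauge; fun_prop) (by unfold Function.uncurry; fun_prop)]
  refine lintegral_congr fun z => lintegral_congr fun w => ?_
  rw [one_mul, ← ENNReal.ofReal_mul (mul_nonneg ht0 hs), ← ENNReal.ofReal_mul hs,
    ← ENNReal.ofReal_mul ht0,
    ← ENNReal.ofReal_add (by positivity) (by positivity),
    ← ENNReal.ofReal_add (by positivity) (by positivity)]
  congr 1
  simp only [convexGauge, Prod.map_fst, Prod.map_snd, id]
  ring

/-- **Triangle comparison / nonnegative curvature.** Let `μ` be an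
optimal coupling for `DD = DD₂` of two metric measure spaces of finite `L²`-size and
let `X_t = (X₀ × X₁, (1−t)d₀ + t d₁, μ)`. Then for every metric measure space
`(X',d',m')` of finite `L²`-size and every `t ∈ [0,1]`:
`DD(X_t,X')² ≥ (1−t)·DD(X₀,X')² + t·DD(X₁,X')² − t(1−t)·DD(X₀,X₁)²`. -/
theorem DD2_triangle_comparison
    {X₀ X₁ X' : Type*}
    [MetricSpace X₀] [CompleteSpace X₀] [TopologicalSpace.SeparableSpace X₀]
    [MeasurableSpace X₀] [BorelSpace X₀]
    [MetricSpace X₁] [CompleteSpace X₁] [TopologicalSpace.SeparableSpace X₁]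
    [MeasurableSpace X₁] [BorelSpace X₁]
    [MetricSpace X'] [CompleteSpace X'] [TopologicalSpace.SeparableSpace X']
    [MeasurableSpace X'] [BorelSpace X']
    (m₀ : Measure X₀) (m₁ : Measure X₁) (m' : Measure X')
    [IsProbabilityMeasure m₀] [IsProbabilityMeasure m₁] [IsProbabilityMeasure m']
    (hsize₀ : (∫⁻ x, ∫⁻ y, ENNReal.ofReal (dist x y ^ 2) ∂m₀ ∂m₀) ≠ ⊤)
    (hsize₁ : (∫⁻ x, ∫⁻ y, ENNReal.ofReal (dist x y ^ 2) ∂m₁ ∂m₁) ≠ ⊤)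
    (hsize' : (∫⁻ x, ∫⁻ y, ENNReal.ofReal (dist x y ^ 2) ∂m' ∂m') ≠ ⊤)
    (μ : Measure (X₀ × X₁)) (hμ : μ ∈ Cpl m₀ m₁)
    (hopt : distortion2 dist dist μ = DD2 dist dist m₀ m₁)
    (t : ℝ) (ht0 : 0 ≤ t) (ht1 : t ≤ 1) :
    (DD2 (convexGauge t) dist μ m').toReal ^ 2 ≥
      (1 - t) * (DD2 dist dist m₀ m').toReal ^ 2
        + t * (DD2 dist dist m₁ m').toReal ^ 2
        - t * (1 - t) * (DD2 dist dist m₀ m₁).toReal ^ 2 := by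
  have := UniformSpace.secondCountable_of_separable X₀
  have := UniformSpace.secondCountable_of_separable X₁
  have := UniformSpace.secondCountable_of_separable X'
  have := isProbabilityMeasure_of_mem_Cpl hμ
  have hs : 0 ≤ 1 - t := sub_nonneg.2 ht1
  have hd₀ : Measurable (Function.uncurry (dist : X₀ → X₀ → ℝ)) := measurable_dist
  have hd₁ : Measurable (Function.uncurry (dist : X₁ → X₁ → ℝ)) := measurable_dist
  have hd' : Measurable (Function.uncurry (dist : X' → X' → ℝ)) := measurable_dist
  have hmap₀ {ν : Measure ((X₀ × X₁) × X')} (hν : ν ∈ Cpl μ m') :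
      ν.map (Prod.map Prod.fst id) ∈ Cpl m₀ m' :=
    hμ.1 ▸ map_prodMap_fst_mem_Cpl hν measurable_fst
  have hmap₁ {ν : Measure ((X₀ × X₁) × X')} (hν : ν ∈ Cpl μ m') :
      ν.map (Prod.map Prod.snd id) ∈ Cpl m₁ m' :=
    hμ.2 ▸ map_prodMap_fst_mem_Cpl hν measurable_snd
  have hidentity {ν : Measure ((X₀ × X₁) × X')} (hν : ν ∈ Cpl μ m') :
      distortion2 (convexGauge t) dist ν ^ 2 +
          ENNReal.ofReal (t * (1 - t)) * DD2 dist dist m₀ m₁ ^ 2 =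
        ENNReal.ofReal (1 - t) * distortion2 dist dist (ν.map (Prod.map Prod.fst id)) ^ 2 +
          ENNReal.ofReal t * distortion2 dist dist (ν.map (Prod.map Prod.snd id)) ^ 2 := by
    have := isProbabilityMeasure_of_mem_Cpl hν
    have h := distortion2_convexGauge_sq_add ν ht0 ht1
    rwa [hν.1, hopt] at h
  have hfin₀₁ : DD2 (dist : X₀ → X₀ → ℝ) (dist : X₁ → X₁ → ℝ) m₀ m₁ ≠ ⊤ :=
    hopt ▸ distortion2_ne_top hd₀ hd₁ hsize₀ hsize₁ hμ
  have hfin : DD2 (convexGauge t : X₀ × X₁ → X₀ × X₁ → ℝ) (dist : X' → X' → ℝ) μ m' ≠ ⊤ := by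
    have hν := prod_mem_Cpl μ m'
    refine ne_top_of_le_ne_top ?_ (DD2_le_distortion2 _ _ hν)
    have h := le_self_add.trans_eq (hidentity hν)
    have hrhs := ENNReal.add_ne_top.2
      ⟨ENNReal.mul_ne_top (ENNReal.ofReal_ne_top (r := 1 - t)) (ENNReal.pow_ne_top (n := 2)
          (distortion2_ne_top hd₀ hd' hsize₀ hsize' (hmap₀ hν))),
        ENNReal.mul_ne_top (ENNReal.ofReal_ne_top (r := t)) (ENNReal.pow_ne_top (n := 2)
          (distortion2_ne_top hd₁ hd' hsize₁ hsize' (hmap₁ hν)))⟩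
    intro htop
    rw [htop] at h
    exact hrhs (top_le_iff.1 (by simpa using h))
  have hcomparison : ENNReal.ofReal (1 - t) * DD2 dist dist m₀ m' ^ 2 +
        ENNReal.ofReal t * DD2 dist dist m₁ m' ^ 2 ≤
      DD2 (convexGauge t) dist μ m' ^ 2 +
        ENNReal.ofReal (t * (1 - t)) * DD2 dist dist m₀ m₁ ^ 2 := by
    refine tsub_le_iff_right.1 (le_DD2_sq fun ν hν => tsub_le_iff_right.2 ?_)
    rw [hidentity hν]
    gcongr
    · exact DD2_le_distortion2 _ _ (hmap₀ hν)
    · exact DD2_le_distortion2 _ _ (hmap₁ hν)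
  have hl : DD2 (convexGauge t) dist μ m' ^ 2 ≠ ⊤ := ENNReal.pow_ne_top hfin
  have hr : ENNReal.ofReal (t * (1 - t)) * DD2 dist dist m₀ m₁ ^ 2 ≠ ⊤ :=
    ENNReal.mul_ne_top ENNReal.ofReal_ne_top (ENNReal.pow_ne_top hfin₀₁)
  have hsum := ne_top_of_le_ne_top (ENNReal.add_ne_top.2 ⟨hl, hr⟩) hcomparison
  have h := ENNReal.toReal_mono (ENNReal.add_ne_top.2 ⟨hl, hr⟩) hcomparison
  rw [ENNReal.toReal_add hl hr, ENNReal.toReal_add (ENNReal.add_ne_top.1 hsum).1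
    (ENNReal.add_ne_top.1 hsum).2] at h
  simp only [ENNReal.toReal_mul, ENNReal.toReal_pow, ENNReal.toReal_ofReal hs,
    ENNReal.toReal_ofReal ht0, ENNReal.toReal_ofReal (mul_nonneg ht0 hs)] at h
  linarith
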